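/- Every nonempty finite simple (C4, diamond, theta, pyramid, prism, even wheel)-free graph that contains no wheel has a bisimplicial vertex, i.e., a vertex v such that N(v) is the union of two cliques. -/

import Mathlib

open SimpleGraph

namespace Paper

variable {V : Type*}

/-- `G` contains an induced subgraph isomorphic to `H`. -/
def ContainsInduced {W : Type*} (G : SimpleGraph V) (H : SimpleGraph W) : Prop :=
  ∃ S : Set V, Nonempty (G.induce S ≃g H)

/-- `G` is `H`-free: no induced subgraph of `G` is isomorphic to `H`. -/
def Free {W : Type*} (G : SimpleGraph V) (H : SimpleGraph W) : Prop :=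
  ¬ ContainsInduced G H

/-- The diamond: `K₄` minus an edge. -/
def diamond : SimpleGraph (Fin 4) :=
  (⊤ : SimpleGraph (Fin 4)).deleteEdges {s(0, 1)}

/-- `S` induces a hole (an induced cycle of length at least 4) in `G`. -/
def IsHoleSet (G : SimpleGraph V) (S : Set V) : Prop :=
  ∃ n : ℕ, 4 ≤ n ∧ Nonempty (G.induce S ≃g cycleGraph n)

/-- `G` contains an even hole. -/
def HasEvenHole (G : SimpleGraph V) : Prop :=
  ∃ S : Set V, ∃ n : ℕ, 4 ≤ n ∧ Even n ∧ Nonempty (G.induce S ≃g cycleGraph n)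

/-- The union of the vertex sets of two walks induces a hole in `G`. -/
def PairHole (G : SimpleGraph V) {a b c d : V} (P : G.Walk a b) (Q : G.Walk c d) : Prop :=
  IsHoleSet G {v | v ∈ P.support ∨ v ∈ Q.support}

/-- `G` contains a theta. -/
def HasTheta (G : SimpleGraph V) : Prop :=
  ∃ (a b : V) (P₁ P₂ P₃ : G.Walk a b),
    a ≠ b ∧ ¬ G.Adj a b ∧
    P₁.IsPath ∧ P₂.IsPath ∧ P₃.IsPath ∧
    PairHole G P₁ P₂ ∧ PairHole G P₁ P₃ ∧ PairHole G P₂ P₃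

/-- `G` contains a pyramid. -/
def HasPyramid (G : SimpleGraph V) : Prop :=
  ∃ (a b₁ b₂ b₃ : V) (P₁ : G.Walk a b₁) (P₂ : G.Walk a b₂) (P₃ : G.Walk a b₃),
    G.Adj b₁ b₂ ∧ G.Adj b₁ b₃ ∧ G.Adj b₂ b₃ ∧
    a ≠ b₁ ∧ a ≠ b₂ ∧ a ≠ b₃ ∧
    P₁.IsPath ∧ P₂.IsPath ∧ P₃.IsPath ∧
    PairHole G P₁ P₂ ∧ PairHole G P₁ P₃ ∧ PairHole G P₂ P₃

/-- `G` contains a prism. -/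
def HasPrism (G : SimpleGraph V) : Prop :=
  ∃ (a₁ a₂ a₃ b₁ b₂ b₃ : V) (P₁ : G.Walk a₁ b₁) (P₂ : G.Walk a₂ b₂) (P₃ : G.Walk a₃ b₃),
    G.Adj a₁ a₂ ∧ G.Adj a₁ a₃ ∧ G.Adj a₂ a₃ ∧
    G.Adj b₁ b₂ ∧ G.Adj b₁ b₃ ∧ G.Adj b₂ b₃ ∧
    ({a₁, a₂, a₃} : Set V) ∩ {b₁, b₂, b₃} = ∅ ∧
    P₁.IsPath ∧ P₂.IsPath ∧ P₃.IsPath ∧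
    PairHole G P₁ P₂ ∧ PairHole G P₁ P₃ ∧ PairHole G P₂ P₃

/-- The neighbors of `v` inside the set `S`. -/
def nbrsIn (G : SimpleGraph V) (S : Set V) (v : V) : Set V :=
  {u | u ∈ S ∧ G.Adj v u}

/-- `(S, v)` is a wheel of `G`: `S` is a hole and `v ∉ S` has at least 3 neighbors in `S`. -/
def IsWheel (G : SimpleGraph V) (S : Set V) (v : V) : Prop :=
  IsHoleSet G S ∧ v ∉ S ∧ 3 ≤ (nbrsIn G S v).ncard

/-- `(S, v)` is an even wheel of `G`. -/
def IsEvenWheel (G : SimpleGraph V) (S : Set V) (v : V) : Prop :=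
  IsWheel G S v ∧ Even (nbrsIn G S v).ncard

def HasWheel (G : SimpleGraph V) : Prop := ∃ (S : Set V) (v : V), IsWheel G S v

def HasEvenWheel (G : SimpleGraph V) : Prop := ∃ (S : Set V) (v : V), IsEvenWheel G S v

/-- A bug: a wheel whose hub has exactly three neighbors in the hole,
exactly two of which are adjacent. -/
def IsBug (G : SimpleGraph V) (S : Set V) (v : V) : Prop :=
  IsWheel G S v ∧ ∃ x y z : V, x ≠ y ∧ x ≠ z ∧ y ≠ z ∧
    nbrsIn G S v = {x, y, z} ∧ G.Adj x y ∧ ¬ G.Adj x z ∧ ¬ G.Adj y z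

/-- A twin wheel: the neighbors of the hub in the hole induce a path of length two. -/
def IsTwinWheel (G : SimpleGraph V) (S : Set V) (v : V) : Prop :=
  IsWheel G S v ∧ ∃ x y z : V, x ≠ y ∧ x ≠ z ∧ y ≠ z ∧
    nbrsIn G S v = {x, y, z} ∧ G.Adj x y ∧ G.Adj y z ∧ ¬ G.Adj x z

/-- A universal wheel: the hub is adjacent to every vertex of the hole. -/
def IsUniversalWheel (G : SimpleGraph V) (S : Set V) (v : V) : Prop :=
  IsWheel G S v ∧ ∀ u ∈ S, G.Adj v u

/-- `G` is a member of the class 𝒞 of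
(C4, diamond, theta, pyramid, prism, even wheel)-free graphs. -/
def InC (G : SimpleGraph V) : Prop :=
  Free G (cycleGraph 4) ∧ Free G diamond ∧ ¬ HasTheta G ∧ ¬ HasPyramid G ∧
    ¬ HasPrism G ∧ ¬ HasEvenWheel G

/-- The independence number of `G`. -/
noncomputable def indepNum (G : SimpleGraph V) : ℕ :=
  sSup {n | ∃ S : Set V, (S.Pairwise fun u v => ¬ G.Adj u v) ∧ S.ncard = n}

/-- The clique number of `G`. -/
noncomputable def cliqueNum (G : SimpleGraph V) : ℕ :=
  sSup {n | ∃ S : Set V, G.IsClique S ∧ S.ncard = n}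

/-- The (vertex) clique cover number of `G`: the minimum number of parts in a
partition of the vertex set of `G` into cliques. -/
noncomputable def cliqueCoverNum (G : SimpleGraph V) : ℕ :=
  sInf {n | ∃ F : Finset (Set V), F.card = n ∧ (∀ C ∈ F, G.IsClique C) ∧
    ∀ v : V, ∃! C : Set V, C ∈ F ∧ v ∈ C}

/-- A tree decomposition of `G`. -/
structure TreeDecomp (G : SimpleGraph V) where
  ι : Type
  tree : SimpleGraph ι
  tree_acyclic : tree.IsAcyclic
  tree_connected : tree.Connected
  bag : ι → Set V
  bag_cover : ∀ v : V, ∃ t, v ∈ bag t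
  bag_edge : ∀ ⦃u v : V⦄, G.Adj u v → ∃ t, u ∈ bag t ∧ v ∈ bag t
  bag_subtree : ∀ v : V, (tree.induce {t | v ∈ bag t}).Connected

/-- The treewidth of `G`: the minimum over tree decompositions of (max bag size − 1). -/
noncomputable def treewidth (G : SimpleGraph V) : ℕ :=
  sInf {k | ∃ D : TreeDecomp G, ∀ t, (D.bag t).ncard ≤ k + 1}

/-- The tree independence number of `G`. -/
noncomputable def treeIndepNum (G : SimpleGraph V) : ℕ :=
  sInf {k | ∃ D : TreeDecomp G, ∀ t, indepNum (G.induce (D.bag t)) ≤ k}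

/-- The tree clique cover number of `G`. -/
noncomputable def treeCliqueCoverNum (G : SimpleGraph V) : ℕ :=
  sInf {k | ∃ D : TreeDecomp G, ∀ t, cliqueCoverNum (G.induce (D.bag t)) ≤ k}

/-- A weight function on a finite graph: values in `[0,1]` summing to `1`. -/
def IsWeightFn [Fintype V] (w : V → ℝ) : Prop :=
  (∀ v, 0 ≤ w v ∧ w v ≤ 1) ∧ ∑ v, w v = 1

/-- The weight of a set of vertices. -/
noncomputable def wSet (w : V → ℝ) (S : Set V) : ℝ := ∑ᶠ x ∈ S, w x

/-- `X` is a `(w, c)`-balanced separator of `G`: every connected component of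
`G − X` has weight at most `c`. -/
def IsBalancedSep (G : SimpleGraph V) (w : V → ℝ) (c : ℝ) (X : Set V) : Prop :=
  ∀ D : (G.induce Xᶜ).ConnectedComponent, wSet w (Subtype.val '' D.supp) ≤ c

/-- `G` has a clique cutset: a clique `C` such that `G − C` is disconnected. -/
def HasCliqueCutset (G : SimpleGraph V) : Prop :=
  ∃ C : Set V, G.IsClique C ∧ ¬ (G.induce Cᶜ).Preconnected

/-- The closed neighborhood of `v`. -/
def closedNbhd (G : SimpleGraph V) (v : V) : Set V := insert v (G.neighborSet v)

/-- The (open) neighborhood of a set `S`: vertices outside `S` with a neighbor in `S`. -/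
def setNbhd (G : SimpleGraph V) (S : Set V) : Set V :=
  {v | v ∉ S ∧ ∃ u ∈ S, G.Adj v u}

/-- `(A, C, B)` is a separation of `G`. -/
def IsSeparation (G : SimpleGraph V) (A C B : Set V) : Prop :=
  A ∪ C ∪ B = Set.univ ∧ Disjoint A C ∧ Disjoint A B ∧ Disjoint C B ∧
    ∀ a ∈ A, ∀ b ∈ B, ¬ G.Adj a b

/-- `v` is a balanced vertex with respect to `w`: every connected component of
`G − N[v]` has weight at most `1/2`. -/
def IsBalancedVtx (G : SimpleGraph V) (w : V → ℝ) (v : V) : Prop :=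
  ∀ D : (G.induce (closedNbhd G v)ᶜ).ConnectedComponent,
    wSet w (Subtype.val '' D.supp) ≤ 1 / 2



section
variable {V : Type*} (G : SimpleGraph V)

/-- induced path given as a list of vertices -/
def IndP : List V → Prop
  | [] => True
  | x :: l => IndP l ∧ ∀ w ∈ l, x ≠ w ∧ (G.Adj x w ↔ l.head? = some w)

variable {G}

theorem indP_append (l₁ l₂ : List V) : IndP G (l₁ ++ l₂) ↔ IndP G l₁ ∧ IndP G l₂ ∧
    ∀ u ∈ l₁, ∀ w ∈ l₂, u ≠ w ∧ (G.Adj u w ↔ (l₁.getLast? = some u ∧ l₂.head? = some w)) := by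
  induction l₁ with
  | nil => simp [IndP]
  | cons x l ih =>
    rcases l with _ | ⟨y, l⟩
    · simp [IndP]
    · have hne : IndP G (y :: l ++ l₂) → ∀ w ∈ l₂, x ≠ w → True := fun _ _ _ _ => trivial
      constructor
      · rintro ⟨h1, h2⟩
        have h3 := ih.1 h1
        refine ⟨⟨h3.1, ?_⟩, h3.2.1, ?_⟩
        · intro w hw
          simpa using h2 w (by simp at hw ⊢; tauto)
        · intro u hu w hw
          rcases List.mem_cons.1 hu with rfl | hu
          · have := h2 w (by simp [hw])
            refine ⟨this.1, ?_⟩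
            have hyw := (h3.2.2 y (by simp) w hw).1
            have hu' : ∀ z ∈ y :: l, u ≠ z := fun z hz => (h2 z (by simp at hz ⊢; tauto)).1
            rw [this.2]
            constructor
            · intro h; simp at h; exact absurd h hyw
            · rintro ⟨h, _⟩
              rw [List.getLast?_cons_cons] at h
              exact absurd rfl (hu' u (List.mem_of_getLast? h))
          · rw [List.getLast?_cons_cons]; exact h3.2.2 u hu w hw
      · rintro ⟨⟨h1, h2⟩, h3, h4⟩
        refine ⟨ih.2 ⟨h1, h3, ?_⟩, ?_⟩
        · intro u hu w hw
          have := h4 u (List.mem_cons_of_mem _ hu) w hw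
          rwa [List.getLast?_cons_cons] at this
        · intro w hw
          rcases List.mem_append.1 hw with hw | hw
          · simpa using h2 w hw
          · have := h4 x (by simp) w hw
            have hyw := (h4 y (by simp) w hw).1
            refine ⟨this.1, ?_⟩
            rw [this.2, List.getLast?_cons_cons]
            constructor
            · rintro ⟨h, _⟩
              exact absurd rfl ((h2 x (List.mem_of_getLast? h)).1)
            · intro h; simp at h; exact absurd h hyw

theorem indP_reverse {l : List V} (h : IndP G l) : IndP G l.reverse := by
  induction l with
  | nil => simp [IndP]
  | cons x l ih =>
    rw [List.reverse_cons, indP_append]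
    refine ⟨ih h.1, by simp [IndP], ?_⟩
    intro u hu w hw
    simp at hu hw
    subst hw
    have := h.2 u hu
    simp only [List.getLast?_reverse, List.head?_cons, and_true]
    exact ⟨this.1.symm, by rw [G.adj_comm, this.2]⟩

theorem indP_nodup {l : List V} (h : IndP G l) : l.Nodup := by
  induction l with
  | nil => simp
  | cons x l ih =>
    rw [List.nodup_cons]
    exact ⟨fun hx => (h.2 x hx).1 rfl, ih h.1⟩

theorem indP_adj {l : List V} (h : IndP G l) : ∀ (i j : ℕ) (hj : j < l.length) (hij : i < j),
    (G.Adj (l[i]'(by omega)) l[j] ↔ j = i + 1) := by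
  induction l with
  | nil => intro i j hj; simp at hj
  | cons x l ih =>
    intro i j hj hij
    obtain ⟨j, rfl⟩ : ∃ k, j = k + 1 := ⟨j - 1, by omega⟩
    have hnd := indP_nodup h.1
    rcases i with _ | i
    · simp only [List.getElem_cons_zero, List.getElem_cons_succ]
      rw [(h.2 _ (List.getElem_mem _)).2]
      simp at hj
      rw [List.head?_eq_getElem?, List.getElem?_eq_getElem (by omega : 0 < l.length)]
      simp only [Option.some.injEq]
      rw [hnd.getElem_inj_iff]; omega
    · simp only [List.getElem_cons_succ]
      simp at hj
      rw [ih h.1 i j hj (by omega)]; omega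

/-- closing an induced path by a vertex `v` adjacent exactly to its ends -/
def HL (G : SimpleGraph V) (v : V) (l : List V) : Prop :=
  IndP G l ∧ v ∉ l ∧ ∃ x y, l.head? = some x ∧ l.getLast? = some y ∧ x ≠ y ∧ ¬ G.Adj x y ∧
    ∀ u ∈ l, (G.Adj v u ↔ u = x ∨ u = y)

theorem HL.hole {v : V} {l : List V} (h : HL G v l) : IsHoleSet G {u | u = v ∨ u ∈ l} := by
  obtain ⟨hi, hv, x, y, hx, hy, hxy, hnxy, hadj⟩ := h
  have hnd := indP_nodup hi
  have hnd' : (v :: l).Nodup := List.nodup_cons.2 ⟨hv, hnd⟩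
  have hne : l ≠ [] := by rintro rfl; simp at hx
  have hpos : 0 < l.length := List.length_pos_iff.2 hne
  have hx0 : x = l[0] := by
    rw [List.head?_eq_getElem?, List.getElem?_eq_getElem hpos] at hx
    exact (Option.some.inj hx).symm
  have hy0 : y = l[l.length - 1] := by
    rw [List.getLast?_eq_getElem?, List.getElem?_eq_getElem (by omega)] at hy
    exact (Option.some.inj hy).symm
  have hlen : 3 ≤ l.length := by
    by_contra hlt
    have : l.length = 1 ∨ l.length = 2 := by omega
    rcases this with h1 | h1
    · apply hxy; rw [hx0, hy0]; simp [h1]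
    · apply hnxy; rw [hx0, hy0, indP_adj hi _ _ _ (by omega)]; omega
  refine ⟨l.length + 1, by omega, ⟨RelIso.symm ?_⟩⟩
  have key : ∀ i j : ℕ, ∀ (hj : j < l.length + 1) (hij : i < j),
      (G.Adj ((v :: l)[i]'(by simp; omega)) ((v :: l)[j]'(by simpa using hj)) ↔
        (j = i + 1 ∨ (i = 0 ∧ j = l.length))) := by
    intro i j hj hij
    obtain ⟨j, rfl⟩ : ∃ k, j = k + 1 := ⟨j - 1, by omega⟩
    rcases i with _ | i
    · simp only [List.getElem_cons_zero, List.getElem_cons_succ]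
      rw [hadj _ (List.getElem_mem _), hx0, hy0, hnd.getElem_inj_iff, hnd.getElem_inj_iff]
      simp only [true_and]
      omega
    · simp only [List.getElem_cons_succ]
      rw [indP_adj hi _ _ _ (by omega)]; omega
  let f : Fin (l.length + 1) → ({u | u = v ∨ u ∈ l} : Set V) := fun i =>
    ⟨(v :: l)[i.1]'(by simp; omega), by
      have : (v :: l)[i.1]'(by simp; omega) ∈ v :: l := List.getElem_mem _
      exact List.mem_cons.1 this⟩
  have hf : Function.Bijective f := by
    constructor
    · intro i j hij
      simp only [f, Subtype.mk.injEq] at hij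
      rw [hnd'.getElem_inj_iff] at hij
      exact Fin.ext hij
    · rintro ⟨u, hu⟩
      have : u ∈ v :: l := by simpa using hu
      obtain ⟨i, hi, hu⟩ := List.getElem_of_mem this
      exact ⟨⟨i, by simpa using hi⟩, Subtype.ext hu⟩
  refine ⟨Equiv.ofBijective f hf, ?_⟩
  intro i j
  have cyc : ∀ i j : Fin (l.length + 1), i.1 < j.1 →
      ((cycleGraph (l.length + 1)).Adj i j ↔ (j.1 = i.1 + 1 ∨ (i.1 = 0 ∧ j.1 = l.length))) := by
    intro i j hij
    rw [cycleGraph_adj', Fin.val_sub, Fin.val_sub]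
    have e1 : (l.length + 1 - j.1 + i.1) % (l.length + 1) = l.length + 1 - j.1 + i.1 :=
      Nat.mod_eq_of_lt (by omega)
    have e2 : (l.length + 1 - i.1 + j.1) % (l.length + 1) = j.1 - i.1 := by
      rw [show l.length + 1 - i.1 + j.1 = (j.1 - i.1) + (l.length + 1) by omega]
      rw [Nat.add_mod_right]; exact Nat.mod_eq_of_lt (by omega)
    rw [e1, e2]; omega
  change G.Adj ((v :: l)[i.1]'(by simp; omega)) ((v :: l)[j.1]'(by simp; omega)) ↔ _
  rcases lt_trichotomy i.1 j.1 with hlt | heq | hgt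
  · rw [key i.1 j.1 j.2 hlt, cyc i j hlt]
  · have : i = j := Fin.ext heq
    subst this; simp
  · rw [G.adj_comm, key j.1 i.1 i.2 hgt, SimpleGraph.adj_comm, cyc j i hgt]

theorem exists_walk {l : List V} : ∀ {v x y : V}, IndP G l → l.head? = some x → l.getLast? = some y →
    G.Adj v x → v ∉ l → ∃ W : G.Walk v y, W.IsPath ∧ W.support = v :: l := by
  induction l with
  | nil => intro v x y _ h; simp at h
  | cons z l ih =>
    intro v x y hi hx hy hvx hv
    simp at hx; subst hx
    rcases l with _ | ⟨t, l⟩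
    · simp at hy; subst hy
      refine ⟨SimpleGraph.Walk.cons hvx .nil, ?_, by simp⟩
      rw [SimpleGraph.Walk.isPath_def]; simpa using hv
    · rw [List.getLast?_cons_cons] at hy
      have hz : z ∉ t :: l := (List.nodup_cons.1 (indP_nodup hi)).1
      obtain ⟨W, hW, hs⟩ := ih (v := z) hi.1 rfl hy ((hi.2 t (by simp)).2.2 rfl) hz
      refine ⟨SimpleGraph.Walk.cons hvx W, ?_, by simp [hs]⟩
      rw [SimpleGraph.Walk.isPath_def, SimpleGraph.Walk.support_cons, hs]
      exact List.nodup_cons.2 ⟨hv, List.nodup_cons.2 ⟨hz, indP_nodup hi.1⟩⟩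

/-- half path: starts at the neighbor `x` of `v`, otherwise avoids `N[v]` -/
def HP (G : SimpleGraph V) (v x : V) (X : List V) : Prop :=
  IndP G X ∧ X.head? = some x ∧ v ∉ X ∧ ∀ u ∈ X, (G.Adj v u ↔ u = x)

theorem HP.walk {v x y : V} {X : List V} (h : HP G v x X) (hy : X.getLast? = some y) :
    ∃ W : G.Walk v y, W.IsPath ∧ W.support = v :: X :=
  exists_walk h.1 h.2.1 hy ((h.2.2.2 x (List.mem_of_head? h.2.1)).2 rfl) h.2.2.1

theorem HP.join {v x y : V} {X Y : List V} (hX : HP G v x X) (hY : HP G v y Y)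
    (hxy : ¬ G.Adj x y)
    (hc : ∀ u ∈ X, ∀ w ∈ Y, u ≠ w ∧ (G.Adj u w ↔ (X.getLast? = some u ∧ Y.getLast? = some w))) :
    HL G v (X ++ Y.reverse) := by
  have hxX := List.mem_of_head? hX.2.1
  have hyY := List.mem_of_head? hY.2.1
  refine ⟨?_, ?_, x, y, ?_, ?_, (hc x hxX y hyY).1, hxy, ?_⟩
  · rw [indP_append]
    refine ⟨hX.1, indP_reverse hY.1, ?_⟩
    intro u hu w hw
    rw [List.head?_reverse]
    exact hc u hu w (by simpa using hw)
  · simp [hX.2.2.1, hY.2.2.1]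
  · rw [List.head?_append, hX.2.1]; rfl
  · rw [List.getLast?_append, List.getLast?_reverse, hY.2.1]; rfl
  · intro u hu
    rcases List.mem_append.1 hu with hu | hu
    · rw [hX.2.2.2 u hu]
      have := (hc u hu y hyY).1
      tauto
    · have hu : u ∈ Y := by simpa using hu
      rw [hY.2.2.2 u hu]
      have := (hc x hxX u hu).1
      constructor
      · tauto
      · rintro (rfl | h)
        · exact absurd rfl this
        · exact h

theorem theta_of {v w x y z : V} {X Y Z : List V} (hvw : v ≠ w) (hnvw : ¬ G.Adj v w)
    (hX : HP G v x (X ++ [w])) (hY : HP G v y (Y ++ [w])) (hZ : HP G v z (Z ++ [w]))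
    (h1 : HL G v (X ++ w :: Y.reverse)) (h2 : HL G v (X ++ w :: Z.reverse))
    (h3 : HL G v (Y ++ w :: Z.reverse)) : HasTheta G := by
  obtain ⟨P, hP, hPs⟩ := hX.walk (y := w) (by simp)
  obtain ⟨Q, hQ, hQs⟩ := hY.walk (y := w) (by simp)
  obtain ⟨R, hR, hRs⟩ := hZ.walk (y := w) (by simp)
  refine ⟨v, w, P, Q, R, hvw, hnvw, hP, hQ, hR, ?_, ?_, ?_⟩
  · have := h1.hole
    unfold PairHole; rw [hPs, hQs]; convert this using 1; ext u; simp; tauto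
  · have := h2.hole
    unfold PairHole; rw [hPs, hRs]; convert this using 1; ext u; simp; tauto
  · have := h3.hole
    unfold PairHole; rw [hQs, hRs]; convert this using 1; ext u; simp; tauto

theorem pyramid_of {v x y z p q r : V} {X Y Z : List V}
    (hX : HP G v x X) (hY : HP G v y Y) (hZ : HP G v z Z)
    (hp : X.getLast? = some p) (hq : Y.getLast? = some q) (hr : Z.getLast? = some r)
    (hpq : G.Adj p q) (hpr : G.Adj p r) (hqr : G.Adj q r)
    (h1 : HL G v (X ++ Y.reverse)) (h2 : HL G v (X ++ Z.reverse))
    (h3 : HL G v (Y ++ Z.reverse)) : HasPyramid G := by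
  obtain ⟨P, hP, hPs⟩ := hX.walk hp
  obtain ⟨Q, hQ, hQs⟩ := hY.walk hq
  obtain ⟨R, hR, hRs⟩ := hZ.walk hr
  have e1 : v ≠ p := by rintro rfl; exact hX.2.2.1 (List.mem_of_getLast? hp)
  have e2 : v ≠ q := by rintro rfl; exact hY.2.2.1 (List.mem_of_getLast? hq)
  have e3 : v ≠ r := by rintro rfl; exact hZ.2.2.1 (List.mem_of_getLast? hr)
  refine ⟨v, p, q, r, P, Q, R, hpq, hpr, hqr, e1, e2, e3, hP, hQ, hR, ?_, ?_, ?_⟩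
  · have := h1.hole
    unfold PairHole; rw [hPs, hQs]; convert this using 1; ext u; simp; tauto
  · have := h2.hole
    unfold PairHole; rw [hPs, hRs]; convert this using 1; ext u; simp; tauto
  · have := h3.hole
    unfold PairHole; rw [hQs, hRs]; convert this using 1; ext u; simp; tauto

theorem exists_first (N : V → Prop) (l : List V) (h : ∃ u ∈ l, N u) :
    ∃ l₁ p l₂, l = l₁ ++ p :: l₂ ∧ N p ∧ ∀ u ∈ l₁, ¬ N u := by
  induction l with
  | nil => simp at h
  | cons x l ih =>
    by_cases hx : N x
    · exact ⟨[], x, l, by simp, hx, by simp⟩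
    · obtain ⟨l₁, p, l₂, rfl, hp, hl⟩ := ih (by
        obtain ⟨u, hu, hN⟩ := h
        rcases List.mem_cons.1 hu with rfl | hu
        · exact absurd hN hx
        · exact ⟨u, hu, hN⟩)
      exact ⟨x :: l₁, p, l₂, by simp, hp, by simpa [hx] using hl⟩

theorem exists_last (N : V → Prop) (l : List V) (h : ∃ u ∈ l, N u) :
    ∃ l₁ p l₂, l = l₁ ++ p :: l₂ ∧ N p ∧ ∀ u ∈ l₂, ¬ N u := by
  obtain ⟨l₁, p, l₂, h1, h2, h3⟩ := exists_first N l.reverse (by simpa using h)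
  refine ⟨l₂.reverse, p, l₁.reverse, ?_, h2, by simpa using h3⟩
  have := congrArg List.reverse h1
  simpa using this

theorem exists_ind (C : Set V) (N : V → Prop) {x y : V}
    (h : Relation.ReflTransGen (fun u w => G.Adj u w ∧ w ∈ C) x y) (hy : N y) :
    ∃ l q, IndP G (l ++ [q]) ∧ (l ++ [q]).head? = some x ∧ (∀ u ∈ l ++ [q], u = x ∨ u ∈ C) ∧
      N q ∧ ∀ u ∈ l, ¬ N u := by
  induction h using Relation.ReflTransGen.head_induction_on with
  | refl => exact ⟨[], y, by simp [IndP], by simp, by simp, hy, by simp⟩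
  | @head x z hxz _ ih =>
    obtain ⟨l, q, hi, hh, hC, hq, hl⟩ := ih
    have hC' : ∀ u ∈ l ++ [q], u ∈ C := fun u hu => by
      rcases hC u hu with rfl | h
      · exact hxz.2
      · exact h
    by_cases hx : N x
    · exact ⟨[], x, by simp [IndP], by simp, by simp, hx, by simp⟩
    by_cases hxl : x ∈ l
    · obtain ⟨l₁, l₂, rfl⟩ := List.append_of_mem hxl
      refine ⟨x :: l₂, q, ?_, by simp, ?_, hq, ?_⟩
      · rw [List.append_assoc, indP_append] at hi; exact hi.2.1
      · intro u hu; right; apply hC'; simp at hu ⊢; tauto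
      · intro u hu; apply hl; simp at hu ⊢; tauto
    have hxq : x ≠ q := by rintro rfl; exact hx hq
    obtain ⟨l₁, p, l₂, h1, h2, h3⟩ := exists_last (fun u => G.Adj x u) (l ++ [q])
      ⟨z, List.mem_of_head? hh, hxz.1⟩
    have hp2 : IndP G (p :: l₂) := by rw [h1, indP_append] at hi; exact hi.2.1
    have hsub : ∀ u ∈ p :: l₂, u ∈ l ++ [q] := fun u hu => by rw [h1]; simp at hu ⊢; tauto
    have hxp : IndP G (x :: p :: l₂) := by
      refine ⟨hp2, ?_⟩
      intro w hw
      refine ⟨?_, ?_⟩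
      · rintro rfl
        have := hsub x hw
        simp at this; tauto
      · simp only [List.head?_cons, Option.some.injEq]
        rcases List.mem_cons.1 hw with rfl | hw'
        · simpa using h2
        · constructor
          · intro h; exact absurd h (h3 w hw')
          · rintro rfl; exact h2
    obtain ⟨m, hm⟩ : ∃ m, p :: l₂ = m ++ [q] ∧ ∀ u ∈ m, u ∈ l := by
      rcases List.eq_nil_or_concat l₂ with rfl | ⟨m, q', rfl⟩
      · have := congrArg List.getLast? h1
        simp at this; subst this
        exact ⟨[], by simp⟩
      · have h1' : l ++ [q] = (l₁ ++ p :: m) ++ [q'] := by rw [h1]; simp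
        obtain ⟨e1, e2⟩ := List.append_inj' h1' rfl
        simp at e2; subst e2
        refine ⟨p :: m, by simp, ?_⟩
        intro u hu; rw [e1]; simp at hu ⊢; tauto
    refine ⟨x :: m, q, ?_, by simp, ?_, hq, ?_⟩
    · rw [List.cons_append, ← hm.1]; exact hxp
    · intro u hu
      rw [List.cons_append, ← hm.1] at hu
      rcases List.mem_cons.1 hu with rfl | hu
      · exact Or.inl rfl
      · exact Or.inr (hC' u (hsub u hu))
    · intro u hu
      rcases List.mem_cons.1 hu with rfl | hu
      · exact hx
      · exact hl u (hm.2 u hu)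
end
section
variable {V : Type*} {G : SimpleGraph V}

set_option maxHeartbeats 2000000 in
/-- main configuration lemma -/
theorem trunk_main {v a b c q : V} {C : Set V} (hT : ¬ HasTheta G) (hPy : ¬ HasPyramid G)
    (hW : ¬ HasWheel G) (hC : ∀ u ∈ C, u ≠ v ∧ ¬ G.Adj v u)
    (va : G.Adj v a) (vb : G.Adj v b) (vc : G.Adj v c)
    (hab : a ≠ b) (nab : ¬ G.Adj a b) (nac : ¬ G.Adj a c) (nbc : ¬ G.Adj b c)
    {L R : List V} (hL : IndP G L) (hLa : L.head? = some a) (hLb : L.getLast? = some b)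
    (hLC : ∀ u ∈ L, u = a ∨ u = b ∨ u ∈ C)
    (hR : IndP G (R ++ [q])) (hRc : (R ++ [q]).head? = some c)
    (hRC : ∀ u ∈ R ++ [q], u = c ∨ u ∈ C)
    (hRL : ∀ u ∈ R, ∀ w ∈ L, ¬ G.Adj u w) (hd : ∀ u ∈ R ++ [q], u ∉ L)
    (ht : ∃ t ∈ L, t ≠ a ∧ t ≠ b ∧ G.Adj q t) : False := by
  have hLnd := indP_nodup hL
  have hRnd := indP_nodup hR
  have haL : a ∈ L := List.mem_of_head? hLa
  have hbL : b ∈ L := List.mem_of_getLast? hLb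
  have hvL : ∀ u ∈ L, u ≠ v ∧ (G.Adj v u ↔ u = a ∨ u = b) := by
    intro u hu
    rcases hLC u hu with rfl | rfl | h
    · exact ⟨va.ne', by simp [va]⟩
    · exact ⟨vb.ne', by simp [vb]⟩
    · refine ⟨(hC u h).1, ⟨fun h' => absurd h' (hC u h).2, ?_⟩⟩
      rintro (rfl | rfl) <;> assumption
  have hLL : HL G v L := ⟨hL, fun h => (hvL v h).1 rfl, a, b, hLa, hLb, hab, nab,
    fun u hu => (hvL u hu).2⟩
  have hRR : HP G v c (R ++ [q]) := by
    refine ⟨hR, hRc, ?_, ?_⟩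
    · intro h
      rcases hRC v h with rfl | h
      · exact vc.ne rfl
      · exact (hC v h).1 rfl
    · intro u hu
      rcases hRC u hu with rfl | h
      · simp [vc]
      · refine ⟨fun h' => absurd h' (hC u h).2, ?_⟩
        rintro rfl; exact vc
  -- prefixes and suffixes of L
  have pre : ∀ X Y, L = X ++ Y → X ≠ [] → Y ≠ [] → HP G v a X := by
    intro X Y e hX hY
    subst e
    have hbY : b ∈ Y := by
      rw [List.getLast?_append_of_ne_nil _ hY] at hLb; exact List.mem_of_getLast? hLb
    have hi := (indP_append _ _).1 hL
    refine ⟨hi.1, ?_, ?_, ?_⟩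
    · rwa [List.head?_append_of_ne_nil _ hX] at hLa
    · intro h; exact (hvL v (by simp [h])).1 rfl
    · intro u hu
      rw [(hvL u (by simp [hu])).2]
      have := (hi.2.2 u hu b hbY).1
      tauto
  have suf : ∀ X Y, L = X ++ Y → X ≠ [] → Y ≠ [] → HP G v b Y.reverse := by
    intro X Y e hX hY
    subst e
    have haX : a ∈ X := by
      rw [List.head?_append_of_ne_nil _ hX] at hLa; exact List.mem_of_head? hLa
    have hi := (indP_append _ _).1 hL
    refine ⟨indP_reverse hi.2.1, ?_, ?_, ?_⟩
    · rw [List.head?_reverse]; rwa [List.getLast?_append_of_ne_nil _ hY] at hLb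
    · intro h; exact (hvL v (by simp at h; simp [h])).1 rfl
    · intro u hu
      simp at hu
      rw [(hvL u (by simp [hu])).2]
      have := (hi.2.2 a haX u hu).1.symm
      tauto
  -- joining something from L with R
  have jn : ∀ x X p, HP G v x X → (∀ u ∈ X, u ∈ L) → ¬ G.Adj x c → X.getLast? = some p →
      G.Adj q p → (∀ u ∈ X, u ≠ p → ¬ G.Adj q u) → HL G v (X ++ (R ++ [q]).reverse) := by
    intro x X p hX hXL hxc hp hqp hX2
    refine hX.join hRR hxc ?_
    intro u hu w hw
    refine ⟨?_, ?_⟩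
    · rintro rfl; exact hd u hw (hXL u hu)
    · simp only [List.getLast?_append, List.getLast?_singleton, Option.some_or, hp,
        Option.some.injEq]
      rcases List.mem_append.1 hw with hw' | hw'
      · constructor
        · intro h; exact absurd h.symm (hRL w hw' u (hXL u hu))
        · rintro ⟨rfl, rfl⟩
          exact hqp.symm
      · simp at hw'; subst hw'
        constructor
        · intro h
          refine ⟨?_, rfl⟩
          by_contra hne
          exact hX2 u hu (Ne.symm hne) h.symm
        · rintro ⟨rfl, _⟩; exact hqp.symm
  obtain ⟨t, htL, hta, htb, hqt⟩ := ht
  obtain ⟨L₁, p, L', hp1, hqp, hL1⟩ := exists_first (fun u => G.Adj q u) L ⟨t, htL, hqt⟩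
  by_cases hex : ∃ u ∈ L', G.Adj q u
  · obtain ⟨M, p', L₂, hp2, hqp', hL2⟩ := exists_last (fun u => G.Adj q u) L' hex
    have e1 : L = (L₁ ++ [p]) ++ (M ++ p' :: L₂) := by rw [hp1, hp2]; simp
    have e2 : L = (L₁ ++ p :: M) ++ (p' :: L₂) := by rw [hp1, hp2]; simp
    have hpL : p ∈ L := by rw [e1]; simp
    have hpL' : p' ∈ L := by rw [e1]; simp
    have hpp' : p ≠ p' := by
      rintro rfl
      rw [e1] at hLnd; simp [List.nodup_append] at hLnd
    by_cases hqc : q = c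
    · subst hqc
      apply hW
      refine ⟨_, q, hLL.hole, ?_, ?_⟩
      · rintro (h | h)
        · exact vc.ne h.symm
        · exact hd q (by simp) h
      · have hsub : ({v, p, p'} : Set V) ⊆ nbrsIn G {u | u = v ∨ u ∈ L} q := by
          rintro u (rfl | rfl | rfl)
          · exact ⟨Or.inl rfl, vc.symm⟩
          · exact ⟨Or.inr hpL, hqp⟩
          · exact ⟨Or.inr hpL', hqp'⟩
        have hfin : (nbrsIn G {u | u = v ∨ u ∈ L} q).Finite := by
          apply Set.Finite.subset (List.finite_toSet (v :: L))
          rintro u ⟨h, _⟩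
          simpa using h
        have hcard : ({v, p, p'} : Set V).ncard = 3 := by
          rw [Set.ncard_eq_three]
          exact ⟨v, p, p', (hvL p hpL).1.symm, (hvL p' hpL').1.symm, hpp', rfl⟩
        rw [← hcard]
        exact Set.ncard_le_ncard hsub hfin
    · have hX := pre (L₁ ++ [p]) (M ++ p' :: L₂) e1 (by simp) (by simp)
      have hY := suf (L₁ ++ p :: M) (p' :: L₂) e2 (by simp) (by simp)
      have j1 := jn a _ p hX (by intro u hu; rw [e1]; simp at hu ⊢; tauto) nac (by simp) hqp (by
        intro u hu hne; apply hL1; simp at hu; tauto)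
      have j2 := jn b _ p' hY (by intro u hu; rw [e2]; simp at hu ⊢; tauto) nbc (by simp) hqp' (by
        intro u hu hne; apply hL2; simp at hu; tauto)
      have hnvq : ¬ G.Adj v q := fun h => hqc ((hRR.2.2.2 q (by simp)).1 h)
      have hvq : v ≠ q := by
        rintro rfl; exact hRR.2.2.1 (by simp)
      rcases M with _ | ⟨m, M⟩
      · -- pyramid
        have hpq : G.Adj p p' := by
          rw [e1] at hL
          have := ((indP_append _ _).1 hL).2.2 p (by simp) p' (by simp)
          rw [this.2]; simp
        refine hPy (pyramid_of hX hY hRR (p := p) (q := p') (r := q) (by simp) (by simp) (by simp)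
          hpq hqp.symm hqp'.symm ?_ j1 j2)
        have : (L₁ ++ [p]) ++ (p' :: L₂).reverse.reverse = L := by rw [e1]; simp
        rw [this]; exact hLL
      · -- theta
        have hnpq : ∀ u ∈ L₁ ++ [p], ∀ w ∈ p' :: L₂, u ≠ w ∧ ¬ G.Adj u w := by
          intro u hu w hw
          have h1 := hL
          rw [e1] at h1
          have := ((indP_append _ _).1 h1).2.2 u hu w (by simp at hw ⊢; tauto)
          refine ⟨this.1, ?_⟩
          rw [this.2]
          rintro ⟨_, h⟩
          simp at h; subst h
          have h2 := hL
          rw [e2] at h2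
          have := ((indP_append _ _).1 h2).2.2 m (by simp) m hw
          exact this.1 rfl
        have hqL : q ∉ L := hd q (by simp)
        have hXL : ∀ u ∈ L₁ ++ [p], u ∈ L := by intro u hu; rw [e1]; simp at hu ⊢; tauto
        have hYL : ∀ u ∈ p' :: L₂, u ∈ L := by intro u hu; rw [e2]; simp at hu ⊢; tauto
        have hpY : HP G v b ((p' :: L₂).reverse ++ [q]) := by
          refine ⟨?_, ?_, ?_, ?_⟩
          · rw [indP_append]
            refine ⟨hY.1, by simp [IndP], ?_⟩
            intro u hu w hw
            simp at hw; subst hw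
            refine ⟨?_, ?_⟩
            · rintro rfl; exact hqL (hYL u (List.mem_reverse.1 hu))
            · simp only [List.getLast?_reverse, List.head?_cons, Option.some.injEq, and_true]
              constructor
              · intro h
                by_contra hne
                refine hL2 u ?_ h.symm
                simp at hu; tauto
              · rintro rfl; exact hqp'.symm
          · rw [List.head?_append, hY.2.1]; rfl
          · intro h
            rcases List.mem_append.1 h with h | h
            · exact hY.2.2.1 h
            · simp at h; exact hvq h
          · intro u hu
            rcases List.mem_append.1 hu with h | h
            · exact hY.2.2.2 u h
            · simp at h; subst h
              refine ⟨fun h => absurd h hnvq, ?_⟩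
              rintro rfl; exact absurd hbL hqL
        have hpX : HP G v a ((L₁ ++ [p]) ++ [q]) := by
          refine ⟨?_, ?_, ?_, ?_⟩
          · rw [indP_append]
            refine ⟨hX.1, by simp [IndP], ?_⟩
            intro u hu w hw
            simp at hw; subst hw
            refine ⟨?_, ?_⟩
            · rintro rfl; exact hqL (hXL u hu)
            · simp only [List.getLast?_append, List.getLast?_singleton, Option.some_or,
                List.head?_cons, Option.some.injEq, and_true]
              constructor
              · intro h
                by_contra hne
                refine hL1 u ?_ h.symm
                simp at hu; tauto
              · rintro rfl; exact hqp.symm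
          · rw [List.head?_append, hX.2.1]; rfl
          · intro h
            rcases List.mem_append.1 h with h | h
            · exact hX.2.2.1 h
            · simp at h; exact hvq h
          · intro u hu
            rcases List.mem_append.1 hu with h | h
            · exact hX.2.2.2 u h
            · simp at h; subst h
              refine ⟨fun h => absurd h hnvq, ?_⟩
              rintro rfl; exact absurd haL hqL
        refine hT (theta_of hvq hnvq hpX hpY hRR ?_ ?_ ?_)
        · have := hpX.join hY nab (by
            intro u hu w hw
            simp only [List.getLast?_append, List.getLast?_singleton, Option.some_or,
              List.getLast?_reverse, List.head?_cons, Option.some.injEq]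
            have hw' : w ∈ p' :: L₂ := List.mem_reverse.1 hw
            rcases List.mem_append.1 hu with h | h
            · have := hnpq u h w hw'
              refine ⟨this.1, fun h' => absurd h' this.2, ?_⟩
              rintro ⟨rfl, _⟩
              exact absurd (hXL _ h) hqL
            · simp at h; subst h
              refine ⟨?_, ?_⟩
              · rintro rfl; exact hqL (hYL _ hw')
              · constructor
                · intro h
                  refine ⟨rfl, ?_⟩
                  by_contra hne
                  refine hL2 w ?_ h
                  rcases List.mem_cons.1 hw' with h' | h'
                  · exact absurd h'.symm hne
                  · exact h'
                · rintro ⟨_, rfl⟩; exact hqp')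
          simpa using this
        · simpa using j1
        · simpa using j2
  · push Not at hex
    -- unique neighbor
    have htp : t = p := by
      rw [hp1] at htL
      simp at htL
      rcases htL with h | h | h
      · exact absurd hqt (hL1 t h)
      · exact h
      · exact absurd hqt (hex t h)
    subst htp
    have hL1n : L₁ ≠ [] := by
      rintro rfl; rw [hp1] at hLa; simp at hLa; exact hta hLa
    have hL2n : L' ≠ [] := by
      rintro rfl; rw [hp1] at hLb; simp at hLb; exact htb hLb
    have e1 : L = (L₁ ++ [t]) ++ L' := by rw [hp1]; simp
    have hX := pre (L₁ ++ [t]) L' e1 (by simp) hL2n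
    have hY := suf L₁ (t :: L') hp1 hL1n (by simp)
    have j1 := jn a _ t hX (by intro u hu; rw [e1]; simp at hu ⊢; tauto) nac (by simp) hqp (by
      intro u hu hne; apply hL1; simp at hu; tauto)
    have j2 := jn b _ t hY (by intro u hu; rw [hp1]; simp at hu ⊢; tauto) nbc (by simp) hqp (by
      intro u hu hne
      rcases List.mem_cons.1 (List.mem_reverse.1 hu) with h | h
      · exact absurd h hne
      · exact hex u h)
    have htL : t ∈ L := by rw [hp1]; simp
    have hnvt : ¬ G.Adj v t := by rw [(hvL t htL).2]; tauto
    have hpR : HP G v c ((R ++ [q]) ++ [t]) := by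
      refine ⟨?_, ?_, ?_, ?_⟩
      · rw [indP_append]
        refine ⟨hR, by simp [IndP], ?_⟩
        intro u hu w hw
        simp at hw; subst hw
        refine ⟨?_, ?_⟩
        · rintro rfl; exact hd u hu htL
        · simp only [List.getLast?_append, List.getLast?_singleton, Option.some_or,
                List.head?_cons, Option.some.injEq, and_true]
          constructor
          · intro h
            by_contra hne
            refine hRL u ?_ w htL h
            simp at hu
            rcases hu with h | h
            · exact h
            · exact absurd h.symm hne
          · rintro rfl; exact hqp
      · rw [List.head?_append, hRR.2.1]; rfl
      · intro h
        rcases List.mem_append.1 h with h | h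
        · exact hRR.2.2.1 h
        · simp at h; exact (hvL t htL).1 h.symm
      · intro u hu
        rcases List.mem_append.1 hu with h | h
        · exact hRR.2.2.2 u h
        · simp at h; subst h
          refine ⟨fun h => absurd h hnvt, ?_⟩
          rintro rfl; exact vc
    refine hT (theta_of (X := L₁) (Y := L'.reverse) (Z := R ++ [q]) (hvL t htL).1.symm hnvt hX
      (by simpa using hY) hpR ?_ ?_ ?_)
    · have : L₁ ++ t :: L'.reverse.reverse = L := by rw [hp1]; simp
      rw [this]; exact hLL
    · simpa using j1
    · simpa using j2
end
section
variable {V : Type*} {G : SimpleGraph V}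

theorem indP_snoc {X : List V} {w b : V} (hX : IndP G (X ++ [w])) (hwb : G.Adj w b)
    (hXb : ∀ u ∈ X, ¬ G.Adj u b) (hb : b ∉ X ++ [w]) : IndP G (X ++ [w] ++ [b]) := by
  rw [indP_append]
  refine ⟨hX, by simp [IndP], ?_⟩
  intro u hu y hy
  simp at hy; subst hy
  refine ⟨fun h => hb (h ▸ hu), ?_⟩
  simp only [List.getLast?_append, List.getLast?_singleton, Option.some_or,
    List.head?_cons, Option.some.injEq, and_true]
  constructor
  · intro h
    by_contra hne
    rcases List.mem_append.1 hu with h' | h'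
    · exact hXb u h' h
    · simp at h'; exact hne h'.symm
  · rintro rfl; exact hwb

theorem indP_left_part {X Y : List V} (h : IndP G (X ++ Y)) : IndP G X := ((indP_append _ _).1 h).1

theorem trunk_one {v a b c z : V} {C : Set V} (hT : ¬ HasTheta G) (hPy : ¬ HasPyramid G)
    (hW : ¬ HasWheel G) (hC : ∀ u ∈ C, u ≠ v ∧ ¬ G.Adj v u)
    (va : G.Adj v a) (vb : G.Adj v b) (vc : G.Adj v c)
    (hab : a ≠ b) (hac : a ≠ c) (hbc : b ≠ c)
    (nab : ¬ G.Adj a b) (nac : ¬ G.Adj a c) (nbc : ¬ G.Adj b c)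
    {X : List V} {w : V} (hX : IndP G (X ++ [w])) (hXc : (X ++ [w]).head? = some c)
    (hXC : ∀ u ∈ X ++ [w], u = c ∨ u ∈ C) (hwb : G.Adj w b) (hXb : ∀ u ∈ X, ¬ G.Adj u b)
    (hz : z ∈ X ++ [w]) (hza : G.Adj z a) : False := by
  have hnC : ∀ u, G.Adj v u → u ∉ C := fun u h h' => (hC u h').2 h
  have hb : b ∉ X ++ [w] := fun h => by
    rcases hXC b h with h | h
    · exact hbc h
    · exact hnC b vb h
  refine trunk_main (a := c) (b := b) (c := a) (q := a) (R := []) (L := X ++ [w] ++ [b]) hT hPy hW hC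
    vc vb va hbc.symm (fun h => nbc h.symm) (fun h => nac h.symm) (fun h => nab h.symm)
    (indP_snoc hX hwb hXb hb) ?_ (by simp) ?_ (by simp [IndP]) (by simp) (by simp) (by simp) ?_ ?_
  · rw [List.head?_append, hXc]; rfl
  · intro u hu
    rcases List.mem_append.1 hu with h | h
    · have := hXC u h; tauto
    · simp at h; tauto
  · intro u hu
    simp only [List.nil_append, List.mem_singleton] at hu
    subst hu
    intro h
    rcases List.mem_append.1 h with h | h
    · rcases hXC u h with h | h
      · exact hac h
      · exact hnC u va h
    · simp at h; exact hab h
  · refine ⟨z, List.mem_append_left _ hz, ?_, ?_, hza.symm⟩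
    · rintro rfl; exact nac hza.symm
    · rintro rfl; exact nab hza.symm

theorem trunk_two {v a b c z q : V} {C : Set V} (hT : ¬ HasTheta G) (hPy : ¬ HasPyramid G)
    (hW : ¬ HasWheel G) (hC : ∀ u ∈ C, u ≠ v ∧ ¬ G.Adj v u)
    (va : G.Adj v a) (vb : G.Adj v b) (vc : G.Adj v c)
    (hab : a ≠ b) (hac : a ≠ c) (hbc : b ≠ c)
    (nab : ¬ G.Adj a b) (nac : ¬ G.Adj a c) (nbc : ¬ G.Adj b c)
    {T R l₁ l₂ : List V} (hTb : IndP G (T ++ [b])) (hTC : ∀ u ∈ T, u ∈ C)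
    (hR : IndP G (R ++ [q])) (hRc : (R ++ [q]).head? = some c)
    (hRC : ∀ u ∈ R ++ [q], u = c ∨ u ∈ C) (hRT : ∀ u ∈ R, ∀ t ∈ T, ¬ G.Adj u t)
    (hRT' : ∀ u ∈ R ++ [q], u ∉ T) (hq : ∃ t ∈ T, G.Adj q t)
    (hRe : R = l₁ ++ z :: l₂) (hza : G.Adj z a) (hzb : ¬ G.Adj z b)
    (hl₁ : ∀ u ∈ l₁, ¬ G.Adj u b) : False := by
  obtain ⟨t₁, t, t₂, rfl, hqt, ht₂⟩ := exists_last (fun u => G.Adj q u) T hq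
  have hWi : IndP G ((R ++ [q]) ++ t :: t₂) := by
    rw [indP_append]
    refine ⟨hR, ?_, ?_⟩
    · have := indP_left_part hTb
      exact ((indP_append _ _).1 this).2.1
    · intro u hu w hw
      have hwT : w ∈ t₁ ++ t :: t₂ := List.mem_append_right _ hw
      refine ⟨fun h => hRT' u hu (h ▸ hwT), ?_⟩
      simp only [List.getLast?_append, List.getLast?_singleton, Option.some_or,
        List.head?_cons, Option.some.injEq]
      rcases List.mem_append.1 hu with h | h
      · refine ⟨fun h' => absurd h' (hRT u h w hwT), ?_⟩
        rintro ⟨rfl, rfl⟩; exact hqt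
      · simp at h; subst h
        constructor
        · intro h
          refine ⟨rfl, ?_⟩
          by_contra hne
          rcases List.mem_cons.1 hw with h' | h'
          · exact hne h'.symm
          · exact ht₂ w h' h
        · rintro ⟨_, rfl⟩; exact hqt
  obtain ⟨y, hy⟩ : ∃ y, (t :: t₂).getLast? = some y :=
    ⟨_, List.getLast?_eq_some_getLast (by simp)⟩
  have hyb : G.Adj y b := by
    have := ((indP_append _ _).1 hTb).2.2 y
      (List.mem_append_right _ (List.mem_of_getLast? hy)) b (by simp)
    rw [this.2, List.getLast?_append_of_ne_nil _ (by simp)]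
    exact ⟨hy, by simp⟩
  obtain ⟨m₁, w, m₂, hY, hwb, hm₁⟩ := exists_first (fun u => G.Adj u b) (l₂ ++ [q] ++ t :: t₂)
    ⟨y, List.mem_append_right _ (List.mem_of_getLast? hy), hyb⟩
  have hWe : (R ++ [q]) ++ t :: t₂ = ((l₁ ++ z :: m₁) ++ [w]) ++ m₂ := by
    have : (R ++ [q]) ++ t :: t₂ = l₁ ++ z :: (l₂ ++ [q] ++ t :: t₂) := by rw [hRe]; simp
    rw [this, hY]; simp
  have hWi' := hWi
  rw [hWe] at hWi'
  refine trunk_one hT hPy hW hC va vb vc hab hac hbc nab nac nbc (X := l₁ ++ z :: m₁) (w := w)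
    (z := z) (indP_left_part hWi') ?_ ?_ hwb ?_ (by simp) hza
  · have h1 : ((R ++ [q]) ++ t :: t₂).head? = some c := by rw [List.head?_append, hRc]; rfl
    rw [hWe, List.head?_append_of_ne_nil _ (by simp)] at h1
    exact h1
  · intro u hu
    have : u ∈ (R ++ [q]) ++ t :: t₂ := by rw [hWe]; exact List.mem_append_left _ hu
    rcases List.mem_append.1 this with h | h
    · exact hRC u h
    · exact Or.inr (hTC u (List.mem_append_right _ h))
  · intro u hu
    rcases List.mem_append.1 hu with h | h
    · exact hl₁ u h
    · rcases List.mem_cons.1 h with rfl | h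
      · exact hzb
      · exact hm₁ u h

/-- connectedness of a vertex set -/
def Conn (G : SimpleGraph V) (C : Set V) : Prop :=
  ∀ u ∈ C, ∀ w ∈ C, Relation.ReflTransGen (fun u w => G.Adj u w ∧ w ∈ C) u w

theorem star {v a b c : V} {C : Set V} (hT : ¬ HasTheta G) (hPy : ¬ HasPyramid G)
    (hW : ¬ HasWheel G) (hC : ∀ u ∈ C, u ≠ v ∧ ¬ G.Adj v u) (hCon : Conn G C)
    (va : G.Adj v a) (vb : G.Adj v b) (vc : G.Adj v c)
    (hab : a ≠ b) (hac : a ≠ c) (hbc : b ≠ c)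
    (nab : ¬ G.Adj a b) (nac : ¬ G.Adj a c) (nbc : ¬ G.Adj b c)
    (ca : ∃ x ∈ C, G.Adj a x) (cb : ∃ x ∈ C, G.Adj b x) (cc : ∃ x ∈ C, G.Adj c x) : False := by
  have hnC : ∀ u, G.Adj v u → u ∉ C := fun u h h' => (hC u h').2 h
  obtain ⟨xa, hxa, haxa⟩ := ca
  obtain ⟨xb, hxb, hbxb⟩ := cb
  obtain ⟨xc, hxc, hcxc⟩ := cc
  obtain ⟨T, hL, hTC, hTn⟩ : ∃ T : List V, IndP G (a :: T ++ [b]) ∧ (∀ u ∈ T, u ∈ C) ∧ T ≠ [] := by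
    obtain ⟨l, q, hi, hh, hlC, hq, hl⟩ := exists_ind (G := G) C (fun u => G.Adj u b)
      (Relation.ReflTransGen.head ⟨haxa, hxa⟩ (hCon xa hxa xb hxb)) hbxb.symm
    rcases l with _ | ⟨a', l⟩
    · simp at hh; subst hh; exact absurd hq nab
    · simp at hh; subst hh
      have hnd := indP_nodup hi
      rw [List.cons_append, List.nodup_cons] at hnd
      have hT' : ∀ u ∈ l ++ [q], u ∈ C := by
        intro u hu
        rcases hlC u (List.mem_cons_of_mem _ hu) with rfl | h
        · exact absurd hu hnd.1
        · exact h
      refine ⟨l ++ [q], ?_, hT', by simp⟩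
      have := indP_snoc (G := G) (X := a' :: l) (w := q) (b := b) hi hq hl (by
        rw [List.cons_append, List.mem_cons]
        rintro (h | h)
        · exact hab h.symm
        · exact hnC b vb (hT' b h))
      simpa using this
  obtain ⟨t0, ht0⟩ := List.exists_mem_of_ne_nil T hTn
  obtain ⟨R, q, hR, hRc, hRC, hq, hRN⟩ := exists_ind (G := G) C (fun u => u ∈ T ∨ ∃ t ∈ T, G.Adj u t)
      (Relation.ReflTransGen.head ⟨hcxc, hxc⟩ (hCon xc hxc t0 (hTC t0 ht0))) (Or.inl ht0)
  have hqT : q ∉ T := by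
    intro hqT
    rcases List.eq_nil_or_concat R with rfl | ⟨R', z, rfl⟩
    · simp at hRc; subst hRc; exact hnC _ vc (hTC _ hqT)
    · have := ((indP_append _ _).1 hR).2.2 z (by simp) q (by simp)
      exact hRN z (by simp) (Or.inr ⟨q, hqT, this.2.2 (by simp)⟩)
  have hq' : ∃ t ∈ T, G.Adj q t := by tauto
  have hRT : ∀ u ∈ R, ∀ t ∈ T, ¬ G.Adj u t := fun u hu t ht h => hRN u hu (Or.inr ⟨t, ht, h⟩)
  have hRT' : ∀ u ∈ R ++ [q], u ∉ T := by
    intro u hu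
    rcases List.mem_append.1 hu with h | h
    · exact fun h' => hRN u h (Or.inl h')
    · simp at h; subst h; exact hqT
  have hTb : IndP G (T ++ [b]) := hL.1
  have hTa : IndP G (T.reverse ++ [a]) := by
    have := indP_reverse (indP_left_part hL)
    simpa using this
  by_cases hz : ∃ z ∈ R, (G.Adj z a ∨ G.Adj z b)
  · obtain ⟨l₁, z, l₂, hRe, hz, hl₁⟩ := exists_first (fun z => G.Adj z a ∨ G.Adj z b) R hz
    push Not at hl₁
    by_cases hza : G.Adj z a
    · by_cases hzb : G.Adj z b
      · have hRe' : R ++ [q] = (l₁ ++ [z]) ++ (l₂ ++ [q]) := by rw [hRe]; simp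
        rw [hRe'] at hR hRc hRC
        refine trunk_one hT hPy hW hC va vb vc hab hac hbc nab nac nbc (X := l₁) (w := z)
          (z := z) (indP_left_part hR) ?_ ?_ hzb (fun u hu => (hl₁ u hu).2) (by simp) hza
        · rwa [List.head?_append_of_ne_nil _ (by simp)] at hRc
        · exact fun u hu => hRC u (List.mem_append_left _ hu)
      · exact trunk_two hT hPy hW hC va vb vc hab hac hbc nab nac nbc hTb hTC hR hRc hRC hRT hRT'
          hq' hRe hza hzb (fun u hu => (hl₁ u hu).2)
    · have hzb : G.Adj z b := by tauto
      exact trunk_two hT hPy hW hC vb va vc hab.symm hbc hac (fun h => nab h.symm) nbc nac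
        hTa (by simpa using hTC) hR hRc hRC (by simpa using hRT) (by simpa using hRT')
          (by simpa using hq') hRe hzb hza (fun u hu => (hl₁ u hu).1)
  · push Not at hz
    refine trunk_main (a := a) (b := b) (c := c) (q := q) (R := R) (L := a :: T ++ [b]) hT hPy hW hC
      va vb vc hab nab nac nbc hL (by simp) (by rw [List.getLast?_append]; simp) ?_ hR hRc hRC ?_ ?_ ?_
    · intro u hu
      simp at hu
      rcases hu with h | h | h
      · exact Or.inl h
      · exact Or.inr (Or.inr (hTC u h))
      · exact Or.inr (Or.inl h)
    · intro u hu w hw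
      simp at hw
      rcases hw with rfl | h | rfl
      · exact (hz u hu).1
      · exact hRT u hu w h
      · exact (hz u hu).2
    · intro u hu hu'
      have h1 : u ≠ a := by
        rintro rfl
        rcases hRC u hu with h | h
        · exact hac h
        · exact hnC u va h
      have h2 : u ≠ b := by
        rintro rfl
        rcases hRC u hu with h | h
        · exact hbc h
        · exact hnC u vb h
      have h3 := hRT' u hu
      simp at hu'; tauto
    · obtain ⟨t, ht, hqt⟩ := hq'
      refine ⟨t, by simp [ht], ?_, ?_, hqt⟩
      · rintro rfl; exact hnC _ va (hTC _ ht)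
      · rintro rfl; exact hnC _ vb (hTC _ ht)

theorem no_diamond (hD : Free G diamond) {s t u w : V} (hst : s ≠ t) (nst : ¬ G.Adj s t)
    (suw : G.Adj u w) (su : G.Adj s u) (sw : G.Adj s w) (tu : G.Adj t u) (tw : G.Adj t w) :
    False := by
  apply hD
  let f : Fin 4 → V := ![s, t, u, w]
  have hf : Function.Injective f := by
    intro i j h
    have := su.ne; have := sw.ne; have := tu.ne; have := tw.ne; have := suw.ne
    fin_cases i <;> fin_cases j <;> simp_all [f]
  refine ⟨Set.range f, ⟨RelIso.symm ⟨Equiv.ofInjective f hf, ?_⟩⟩⟩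
  intro i j
  change G.Adj (f i) (f j) ↔ diamond.Adj i j
  have := su.symm; have := sw.symm; have := tu.symm; have := tw.symm; have := suw.symm
  have nts : ¬ G.Adj t s := fun h => nst h.symm
  fin_cases i <;> fin_cases j <;> simp_all [f, diamond]

theorem bisimplicial_of (hD : Free G diamond) (v : V)
    (h : ∀ a b c, G.Adj v a → G.Adj v b → G.Adj v c → a ≠ b → a ≠ c → b ≠ c →
      ¬ G.Adj a b → ¬ G.Adj a c → ¬ G.Adj b c → False) :
    ∃ K₁ K₂ : Set V, G.IsClique K₁ ∧ G.IsClique K₂ ∧ G.neighborSet v = K₁ ∪ K₂ := by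
  by_cases hc : G.IsClique (G.neighborSet v)
  · exact ⟨_, _, hc, hc, (Set.union_self _).symm⟩
  · have hc' : ∃ a b, G.Adj v a ∧ G.Adj v b ∧ a ≠ b ∧ ¬ G.Adj a b := by
      by_contra hcon
      push Not at hcon
      exact hc fun x hx y hy hxy => hcon x y hx hy hxy
    obtain ⟨a, b, va, vb, hab, nab⟩ := hc'
    have cl : ∀ a, G.Adj v a → G.IsClique {x | G.Adj v x ∧ (x = a ∨ G.Adj x a)} := by
      rintro a va x ⟨hx, hx'⟩ y ⟨hy, hy'⟩ hxy
      rcases hx' with rfl | hx'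
      · rcases hy' with rfl | hy'
        · exact absurd rfl hxy
        · exact hy'.symm
      · rcases hy' with rfl | hy'
        · exact hx'
        · by_contra hn
          exact no_diamond hD hxy hn va hx.symm hx' hy.symm hy'
    refine ⟨_, _, cl a va, cl b vb, ?_⟩
    ext x
    simp only [mem_neighborSet, Set.mem_union, Set.mem_ofPred_eq]
    constructor
    · intro hx
      by_contra hcon
      push Not at hcon
      have h1 := hcon.1 hx
      have h2 := hcon.2 hx
      exact h a b x va vb hx hab h1.1.symm h2.1.symm nab (fun h => h1.2 h.symm)
        (fun h => h2.2 h.symm)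
    · tauto

end

theorem statement17 {V : Type} [Fintype V] [Nonempty V] (G : SimpleGraph V)
    (h : InC G) (hw : ¬ HasWheel G) :
    ∃ v : V, ∃ K₁ K₂ : Set V, G.IsClique K₁ ∧ G.IsClique K₂ ∧
      G.neighborSet v = K₁ ∪ K₂ := by
  obtain ⟨_, hD, hT, hPy, _, _⟩ := h
  let P : Set (V × Set V) := {p | p.2.Nonempty ∧ Conn G p.2 ∧ (∀ u ∈ p.2, u ≠ p.1 ∧ ¬ G.Adj p.1 u) ∧
    ∀ u ∈ p.2, G.Reachable u p.1}
  by_cases hP : P.Nonempty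
  · obtain ⟨⟨v, C⟩, ⟨hne, hCon, hC, hre⟩, hmax⟩ :=
      Set.exists_max_image P (fun p => p.2.ncard) (Set.toFinite P) hP
    simp only at hne hCon hC hre hmax
    refine ⟨v, bisimplicial_of hD v ?_⟩
    -- vertices outside `C ∪ N(C)` are complete to `N(C)`
    have comp : ∀ u s, G.Reachable u v → u ∉ C → (∀ x ∈ C, ¬ G.Adj u x) → s ∉ C →
        (∃ x ∈ C, G.Adj s x) → G.Adj u s := by
      intro u s hru huC hnu hsC ⟨x, hx, hsx⟩
      by_contra hns
      have hmem : (u, insert s C) ∈ P := by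
        refine ⟨⟨s, Set.mem_insert _ _⟩, ?_, ?_, ?_⟩
        · have hmono : ∀ y ∈ C, ∀ z ∈ C,
              Relation.ReflTransGen (fun u w => G.Adj u w ∧ w ∈ insert s C) y z :=
            fun y hy z hz => Relation.ReflTransGen.mono
              (fun _ _ hh => ⟨hh.1, Set.mem_insert_of_mem _ hh.2⟩) _ _ (hCon y hy z hz)
          rintro y (rfl | hy) z (rfl | hz)
          · exact .refl
          · exact .head ⟨hsx, Set.mem_insert_of_mem _ hx⟩ (hmono x hx z hz)
          · exact .tail (hmono y hy x hx) ⟨hsx.symm, Set.mem_insert _ _⟩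
          · exact hmono y hy z hz
        · rintro y (rfl | hy)
          · refine ⟨?_, hns⟩
            rintro rfl; exact hnu x hx hsx
          · exact ⟨fun e => huC ((show y = u from e) ▸ hy), hnu y hy⟩
        · rintro y (rfl | hy)
          · exact (hsx.reachable.trans (hre x hx)).trans hru.symm
          · exact (hre y hy).trans hru.symm
      have := hmax _ hmem
      simp only at this
      rw [Set.ncard_insert_of_notMem hsC (Set.toFinite _)] at this
      omega
    have hvC : v ∉ C := fun hv => (hC v hv).1 rfl
    -- `N(C)` is nonempty
    obtain ⟨s, hsC, hs⟩ : ∃ s, s ∉ C ∧ ∃ x ∈ C, G.Adj s x := by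
      obtain ⟨x, hx⟩ := hne
      obtain ⟨W⟩ := hre x hx
      obtain ⟨d, _, hd1, hd2⟩ := W.exists_boundary_dart C hx hvC
      exact ⟨d.snd, hd2, d.fst, hd1, d.adj.symm⟩
    have hvs := comp v s (.refl _) hvC (fun x hx => (hC x hx).2) hsC hs
    intro a b c va vb vc hab hac hbc nab nac nbc
    have hnC : ∀ u, G.Adj v u → u ∉ C := fun u h h' => (hC u h').2 h
    have cs : ∀ u t, G.Adj v u → ¬ (∃ x ∈ C, G.Adj u x) → t ∉ C → (∃ x ∈ C, G.Adj t x) →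
        G.Adj u t := by
      intro u t hu hu' ht ht'
      push Not at hu'
      exact comp u t hu.symm.reachable (hnC u hu) hu' ht ht'
    by_cases ha : ∃ x ∈ C, G.Adj a x
    · by_cases hb : ∃ x ∈ C, G.Adj b x
      · by_cases hc : ∃ x ∈ C, G.Adj c x
        · exact star hT hPy hw hC hCon va vb vc hab hac hbc nab nac nbc ha hb hc
        · exact nac (cs c a vc hc (hnC a va) ha).symm
      · exact nab (cs b a vb hb (hnC a va) ha).symm
    · by_cases hb : ∃ x ∈ C, G.Adj b x
      · exact nab (cs a b va ha (hnC b vb) hb)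
      · exact no_diamond hD hab nab hvs va.symm (cs a s va ha hsC hs) vb.symm (cs b s vb hb hsC hs)
  · obtain ⟨v⟩ := ‹Nonempty V›
    refine ⟨v, bisimplicial_of hD v ?_⟩
    intro a b c va vb _ hab _ _ nab _ _
    refine hP ⟨(a, {b}), Set.singleton_nonempty _, ?_, ?_, ?_⟩
    · rintro u rfl w rfl; exact .refl
    · rintro u rfl; exact ⟨hab.symm, nab⟩
    · rintro u rfl; exact vb.symm.reachable.trans va.reachable
end Paper
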